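/- Let N ≥ 4 be a real number and let m1, m2, m3 be reals with 0 ≤ m1 ≤ m2 ≤ m3 ≤ 1 satisfying the Region I condition m1 + m2 + m3 + 2(m2−m1)/(N−1) + 2(m3−m2)/(N−2) ≤ 1. Then the maximum defining R_coded(m1,m2,m3,N) is attained by its first term, i.e., R_coded(m1,m2,m3,N) = 3 − 3m1 − 2m2 − m3 − 3(m2−m1)/(N−1) − 2(m3−m2)/(N−2). -/

import Mathlib

/-- Coded-placement worst-case delivery load for the three-user system. -/
noncomputable def Rcoded3 (m1 m2 m3 N : ℝ) : ℝ :=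
  max (max (3 - 3*m1 - 2*m2 - m3 - 3*(m2 - m1)/(N - 1) - 2*(m3 - m2)/(N - 2))
           (5/3 - m1 - (2/3)*m2 - (1/3)*m3 - (m2 - m1)/(3*(N - 1))))
      (max (2 - 2*m1 - m2 - (m2 - m1)/(N - 1)) (1 - m1))

theorem region_I_first_term_attains_max (N m1 m2 m3 : ℝ)
    (hN : 4 ≤ N) (h0 : 0 ≤ m1) (h12 : m1 ≤ m2) (h23 : m2 ≤ m3) (h31 : m3 ≤ 1)
    (hregI : m1 + m2 + m3 + 2*(m2 - m1)/(N - 1) + 2*(m3 - m2)/(N - 2) ≤ 1) :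
    Rcoded3 m1 m2 m3 N
      = 3 - 3*m1 - 2*m2 - m3 - 3*(m2 - m1)/(N - 1) - 2*(m3 - m2)/(N - 2) := by
  have ha : 0 ≤ (m2 - m1)/(N - 1) := div_nonneg (by linarith) (by linarith)
  have hb : 0 ≤ (m3 - m2)/(N - 2) := div_nonneg (by linarith) (by linarith)
  have hdiv : (m2 - m1)/(3*(N - 1)) = (m2 - m1)/(N - 1)/3 := by
    rw [mul_comm, div_mul_eq_div_div]
  rw [mul_div_assoc, mul_div_assoc] at hregI
  rw [Rcoded3, mul_div_assoc 3, mul_div_assoc 2, hdiv]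
  apply le_antisymm
  · refine max_le (max_le le_rfl ?_) (max_le ?_ ?_) <;> linarith
  · exact (le_max_left _ _).trans (le_max_left _ _)
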